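/- arXiv:2601.19284 — 2 statements merged into one kernel-verified Lean document; each statement's English description precedes it below -/
import Mathlib

section
/- Let γ ∈ (0,1], ν > 0, K ∈ S_γ(ν), and let K' ∈ ℝ^{m×p} satisfy ‖K − K'‖ ≤ D where D = 1/(8κ³ψφ). Then K' ∈ S_γ and ‖P_K(γ) − P_{K'}(γ)‖ ≤ 16κ⁷ℓ₁ψφ·‖K − K'‖. -/
open Matrix

noncomputable section

/-- Spectral radius of a real square matrix: the largest modulus of a complex eigenvalue. -/
def specRad {n : ℕ} (M : Matrix (Fin n) (Fin n) ℝ) : ℝ :=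
  sSup {r : ℝ | ∃ μ ∈ spectrum ℂ (M.map (algebraMap ℝ ℂ)), r = ‖μ‖}

/-- Spectral (ℓ²→ℓ² operator) norm of a real matrix. -/
def spNorm {a b : ℕ} (M : Matrix (Fin a) (Fin b) ℝ) : ℝ :=
  ‖LinearMap.toContinuousLinearMap (Matrix.toEuclideanLin M)‖

/-- Frobenius norm of a real matrix. -/
def frobNorm {a b : ℕ} (M : Matrix (Fin a) (Fin b) ℝ) : ℝ :=
  Real.sqrt (∑ i, ∑ j, (M i j) ^ 2)

/-- Euclidean norm of a vector. -/
def vecNorm {a : ℕ} (x : Fin a → ℝ) : ℝ :=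
  Real.sqrt (∑ i, (x i) ^ 2)

variable {n m p : ℕ}

/-- Closed-loop matrix `A - BKC`. -/
def Acl (A : Matrix (Fin n) (Fin n) ℝ) (B : Matrix (Fin n) (Fin m) ℝ)
    (C : Matrix (Fin p) (Fin n) ℝ) (K : Matrix (Fin m) (Fin p) ℝ) : Matrix (Fin n) (Fin n) ℝ :=
  A - B * K * C

/-- Membership in the stabilizing set `S_γ`: `√γ · ρ(A − BKC) < 1`. -/
def inS (A : Matrix (Fin n) (Fin n) ℝ) (B : Matrix (Fin n) (Fin m) ℝ)
    (C : Matrix (Fin p) (Fin n) ℝ) (γ : ℝ) (K : Matrix (Fin m) (Fin p) ℝ) : Prop :=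
  Real.sqrt γ * specRad (Acl A B C K) < 1

/-- The solution `P_K(γ) = Σ_{t} γ^t ((A−BKC)ᵀ)^t (Q + CᵀKᵀRKC) (A−BKC)^t` of the
discounted Lyapunov equation. -/
def Pmat (A : Matrix (Fin n) (Fin n) ℝ) (B : Matrix (Fin n) (Fin m) ℝ)
    (C : Matrix (Fin p) (Fin n) ℝ) (Q : Matrix (Fin n) (Fin n) ℝ) (R : Matrix (Fin m) (Fin m) ℝ)
    (γ : ℝ) (K : Matrix (Fin m) (Fin p) ℝ) : Matrix (Fin n) (Fin n) ℝ :=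
  ∑' t : ℕ, γ ^ t • ((Acl A B C K)ᵀ ^ t * (Q + Cᵀ * Kᵀ * R * K * C) * (Acl A B C K) ^ t)

/-- The Gramian `Σ_K(γ) = Σ_{t} γ^t (A−BKC)^t ((A−BKC)ᵀ)^t`. -/
def Smat (A : Matrix (Fin n) (Fin n) ℝ) (B : Matrix (Fin n) (Fin m) ℝ)
    (C : Matrix (Fin p) (Fin n) ℝ) (γ : ℝ) (K : Matrix (Fin m) (Fin p) ℝ) :
    Matrix (Fin n) (Fin n) ℝ :=
  ∑' t : ℕ, γ ^ t • ((Acl A B C K) ^ t * ((Acl A B C K)ᵀ) ^ t)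

/-- The discounted cost `J_γ(K) = Tr(P_K(γ))`. -/
def Jcost (A : Matrix (Fin n) (Fin n) ℝ) (B : Matrix (Fin n) (Fin m) ℝ)
    (C : Matrix (Fin p) (Fin n) ℝ) (Q : Matrix (Fin n) (Fin n) ℝ) (R : Matrix (Fin m) (Fin m) ℝ)
    (γ : ℝ) (K : Matrix (Fin m) (Fin p) ℝ) : ℝ :=
  (Pmat A B C Q R γ K).trace

/-- `E_K = (R + γBᵀP_K(γ)B)KC − γBᵀP_K(γ)A`. -/
def Egrad (A : Matrix (Fin n) (Fin n) ℝ) (B : Matrix (Fin n) (Fin m) ℝ)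
    (C : Matrix (Fin p) (Fin n) ℝ) (Q : Matrix (Fin n) (Fin n) ℝ) (R : Matrix (Fin m) (Fin m) ℝ)
    (γ : ℝ) (K : Matrix (Fin m) (Fin p) ℝ) : Matrix (Fin m) (Fin n) ℝ :=
  (R + γ • (Bᵀ * Pmat A B C Q R γ K * B)) * K * C - γ • (Bᵀ * Pmat A B C Q R γ K * A)

/-- The closed-form gradient `∇J_γ(K) = 2 E_K Σ_K(γ) Cᵀ`. -/
def gradJ (A : Matrix (Fin n) (Fin n) ℝ) (B : Matrix (Fin n) (Fin m) ℝ)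
    (C : Matrix (Fin p) (Fin n) ℝ) (Q : Matrix (Fin n) (Fin n) ℝ) (R : Matrix (Fin m) (Fin m) ℝ)
    (γ : ℝ) (K : Matrix (Fin m) (Fin p) ℝ) : Matrix (Fin m) (Fin p) ℝ :=
  (2 : ℝ) • (Egrad A B C Q R γ K * Smat A B C γ K * Cᵀ)

end

section Auxiliary

open scoped Matrix.Norms.L2Operator
open Filter Topology

theorem dotProduct_self_eq_norm_sq {a : ℕ} (v : Fin a → ℝ) :
    v ⬝ᵥ v = ‖WithLp.toLp 2 v‖ ^ 2 := by
  rw [EuclideanSpace.real_norm_sq_eq]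
  simp [dotProduct, sq]

theorem dotProduct_congruence_mulVec {a b : ℕ} (M : Matrix (Fin a) (Fin b) ℝ)
    (W : Matrix (Fin a) (Fin a) ℝ) (x : Fin b → ℝ) :
    x ⬝ᵥ ((Mᵀ * W * M) *ᵥ x) = (M *ᵥ x) ⬝ᵥ (W *ᵥ (M *ᵥ x)) := by
  rw [← mulVec_mulVec, ← mulVec_mulVec, dotProduct_mulVec, vecMul_transpose]

theorem dotProduct_gram_mulVec {a b : ℕ} (S : Matrix (Fin a) (Fin b) ℝ) (x : Fin b → ℝ) :
    x ⬝ᵥ ((Sᵀ * S) *ᵥ x) = ‖WithLp.toLp 2 (S *ᵥ x)‖ ^ 2 := by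
  rw [← dotProduct_self_eq_norm_sq, ← mulVec_mulVec, dotProduct_mulVec, vecMul_transpose]

open scoped MatrixOrder in
theorem exists_eq_gram {a : ℕ} {P : Matrix (Fin a) (Fin a) ℝ} (hP : P.PosSemidef) :
    ∃ S : Matrix (Fin a) (Fin a) ℝ, P = Sᵀ * S := by
  obtain ⟨S, hS⟩ := CStarAlgebra.nonneg_iff_eq_star_mul_self.mp (nonneg_iff_posSemidef.mpr hP)
  exact ⟨S, by rw [hS, star_eq_conjTranspose, conjTranspose_eq_transpose_of_trivial]⟩

theorem norm_mulVec_le {a b : ℕ} (M : Matrix (Fin a) (Fin b) ℝ) (x : Fin b → ℝ) :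
    ‖WithLp.toLp 2 (M *ᵥ x)‖ ≤ ‖M‖ * ‖WithLp.toLp 2 x‖ :=
  l2_opNorm_mulVec M (WithLp.toLp 2 x)

theorem norm_le_of_forall_mulVec_le {a b : ℕ} {M : Matrix (Fin a) (Fin b) ℝ} {c : ℝ} (hc : 0 ≤ c)
    (h : ∀ x, ‖WithLp.toLp 2 (M *ᵥ x)‖ ≤ c * ‖WithLp.toLp 2 x‖) : ‖M‖ ≤ c := by
  rw [l2_opNorm_def]
  exact ContinuousLinearMap.opNorm_le_bound _ hc fun x => h x.ofLp

theorem norm_gram_mulVec_sq_le_trace {a : ℕ} (S : Matrix (Fin a) (Fin a) ℝ) (x : Fin a → ℝ) :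
    ‖WithLp.toLp 2 (S *ᵥ x)‖ ^ 2 ≤ (Sᵀ * S).trace * ‖WithLp.toLp 2 x‖ ^ 2 := by
  rw [EuclideanSpace.real_norm_sq_eq, EuclideanSpace.real_norm_sq_eq, trace_mul_comm]
  simp only [trace, diag_apply, mul_apply, transpose_apply, Finset.sum_mul, mulVec, dotProduct]
  refine Finset.sum_le_sum fun i _ => ?_
  simpa [← Finset.sum_mul, sq] using Finset.sum_mul_sq_le_sq_mul_sq Finset.univ (S i) x

theorem norm_le_of_abs_dotProduct_mulVec_le {a : ℕ} {D : Matrix (Fin a) (Fin a) ℝ}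
    (hD : D.IsSymm) {c : ℝ} (hc : 0 ≤ c)
    (h : ∀ x, |x ⬝ᵥ (D *ᵥ x)| ≤ c * ‖WithLp.toLp 2 x‖ ^ 2) : ‖D‖ ≤ c := by
  have polar (x y : Fin a → ℝ) :
      4 * (y ⬝ᵥ (D *ᵥ x)) ≤ 2 * c * (x ⬝ᵥ x + y ⬝ᵥ y) := by
    have h₁ := (abs_le.mp (h (x + y))).2
    have h₂ := (abs_le.mp (h (x - y))).1
    have hs : x ⬝ᵥ (D *ᵥ y) = y ⬝ᵥ (D *ᵥ x) := by
      rw [dotProduct_mulVec, ← mulVec_transpose, hD.eq, dotProduct_comm]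
    rw [← dotProduct_self_eq_norm_sq] at h₁ h₂
    simp only [mulVec_add, mulVec_sub, dotProduct_add, dotProduct_sub, add_dotProduct,
      sub_dotProduct, hs, dotProduct_comm y x] at h₁ h₂
    linarith
  refine norm_le_of_forall_mulVec_le hc fun x => ?_
  set u := ‖WithLp.toLp 2 x‖ with hu
  set w := ‖WithLp.toLp 2 (D *ᵥ x)‖ with hw
  have hu0 : 0 ≤ u := norm_nonneg _
  have hw0 : 0 ≤ w := norm_nonneg _
  have key := polar (w • x) (u • (D *ᵥ x))
  simp only [mulVec_smul, smul_dotProduct, dotProduct_smul, dotProduct_self_eq_norm_sq,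
    smul_eq_mul, ← hu, ← hw] at key
  rcases hw0.eq_or_lt with hw' | hw'
  · rw [← hw']; positivity
  rcases hu0.eq_or_lt with hu' | hu'
  · have hx : x = 0 := by
      have : WithLp.toLp 2 x = 0 := norm_eq_zero.mp (hu.symm.trans hu'.symm)
      simpa using this
    rw [hw, hx]
    simp only [mulVec_zero, WithLp.toLp_zero, norm_zero]
    positivity
  have h3 : (u * w ^ 2) * w ≤ (u * w ^ 2) * (c * u) := by nlinarith
  exact le_of_mul_le_mul_left h3 (by positivity)

/-- Gelfand's formula, for a real matrix: powers decay geometrically below the unit circle. -/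
theorem exists_norm_pow_le_of_specRad_lt {a : ℕ} (ha : 1 ≤ a) (M : Matrix (Fin a) (Fin a) ℝ)
    {s : ℝ} (hs : 0 ≤ s) (h : s * specRad M < 1) :
    ∃ c q : ℝ, 0 ≤ q ∧ q < 1 ∧ ∀ t : ℕ, ‖(s • M) ^ t‖ ≤ c * q ^ t := by
  have : NeZero a := ⟨by omega⟩
  set Mc : Matrix (Fin a) (Fin a) ℂ := M.map (algebraMap ℝ ℂ) with hMc
  have hbdd : BddAbove {r : ℝ | ∃ μ ∈ spectrum ℂ Mc, r = ‖μ‖} := by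
    refine ⟨‖Mc‖, ?_⟩
    rintro r ⟨μ, hμ, rfl⟩
    exact spectrum.norm_le_norm_of_mem hμ
  have hle : ∀ μ ∈ spectrum ℂ Mc, ‖μ‖ ≤ specRad M := fun μ hμ => le_csSup hbdd ⟨μ, hμ, rfl⟩
  have hrad0 : 0 ≤ specRad M := by
    obtain ⟨μ, hμ⟩ := spectrum.nonempty Mc
    exact (norm_nonneg μ).trans (hle μ hμ)
  obtain ⟨ρ, hρ, hsρ⟩ : ∃ ρ, specRad M < ρ ∧ s * ρ < 1 := by
    have hcont : Tendsto (fun ρ => s * ρ) (𝓝[>] (specRad M)) (𝓝 (s * specRad M)) :=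
      ((continuous_const.mul continuous_id).tendsto _).mono_left nhdsWithin_le_nhds
    obtain ⟨ρ, h₁, h₂⟩ := ((hcont.eventually (gt_mem_nhds h)).and self_mem_nhdsWithin).exists
    exact ⟨ρ, h₂, h₁⟩
  have hρ0 : 0 < ρ := hrad0.trans_lt hρ
  have hsr : spectralRadius ℂ Mc < ENNReal.ofReal ρ := by
    refine spectrum.spectralRadius_lt_of_forall_lt Mc (r := ρ.toNNReal) fun μ hμ => ?_
    rw [← NNReal.coe_lt_coe, coe_nnnorm, Real.coe_toNNReal _ hρ0.le]
    exact (hle μ hμ).trans_lt hρ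
  have hev : ∀ᶠ t : ℕ in atTop, ‖Mc ^ t‖ ≤ ρ ^ t := by
    filter_upwards [(spectrum.pow_norm_pow_one_div_tendsto_nhds_spectralRadius Mc).eventually
      (gt_mem_nhds hsr), eventually_gt_atTop 0] with t ht ht0
    have h₁ := (ENNReal.ofReal_lt_ofReal_iff hρ0).mp ht
    have h₂ := pow_le_pow_left₀ (by positivity) h₁.le t
    rwa [one_div, Real.rpow_inv_natCast_pow (norm_nonneg _) ht0.ne'] at h₂
  obtain ⟨N, hN⟩ := eventually_atTop.mp hev
  let re : Matrix (Fin a) (Fin a) ℂ →L[ℝ] Matrix (Fin a) (Fin a) ℝ :=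
    LinearMap.toContinuousLinearMap Complex.reLm.mapMatrix
  have hre (t : ℕ) : ‖M ^ t‖ ≤ ‖re‖ * ‖Mc ^ t‖ := by
    have : M ^ t = re (Mc ^ t) := by
      have h₁ : Mc ^ t = (M ^ t).map (algebraMap ℝ ℂ) := by
        rw [hMc, Matrix.map_pow]
      rw [h₁]
      ext i j
      simp [re]
    rw [this]
    exact re.le_opNorm _
  have hq (t : ℕ) : 0 ≤ ∑ k ∈ Finset.range N, ‖Mc ^ k‖ / ρ ^ k :=
    Finset.sum_nonneg fun k _ => by positivity
  refine ⟨‖re‖ * (1 + ∑ k ∈ Finset.range N, ‖Mc ^ k‖ / ρ ^ k), s * ρ, by positivity, hsρ,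
    fun t => ?_⟩
  have hMt : ‖Mc ^ t‖ ≤ (1 + ∑ k ∈ Finset.range N, ‖Mc ^ k‖ / ρ ^ k) * ρ ^ t := by
    rcases le_or_gt N t with htN | htN
    · refine (hN t htN).trans (le_mul_of_one_le_left (by positivity) ?_)
      linarith [hq t]
    · rw [← div_le_iff₀ (by positivity)]
      have := Finset.single_le_sum (f := fun k => ‖Mc ^ k‖ / ρ ^ k)
        (fun k _ => by positivity) (Finset.mem_range.mpr htN)
      linarith
  calc ‖(s • M) ^ t‖ = s ^ t * ‖M ^ t‖ := by
        rw [smul_pow, norm_smul, Real.norm_of_nonneg (by positivity)]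
    _ ≤ s ^ t * (‖re‖ * ((1 + ∑ k ∈ Finset.range N, ‖Mc ^ k‖ / ρ ^ k) * ρ ^ t)) := by
        gcongr
        exact (hre t).trans (by gcongr)
    _ = _ := by rw [mul_pow]; ring

theorem specRad_le_of_norm_pow_le {a : ℕ} (M : Matrix (Fin a) (Fin a) ℝ)
    {c r s : ℝ} (hs : 0 < s) (hr : 0 < r) (h : ∀ t : ℕ, ‖(s • M) ^ t‖ ≤ c * r ^ t) :
    s * specRad M ≤ r := by
  suffices hsup : specRad M ≤ r / s by
    rw [le_div_iff₀ hs] at hsup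
    linarith
  refine Real.sSup_le ?_ (by positivity)
  rintro _ ⟨μ, hμ, rfl⟩
  have : Nonempty (Fin a) := by
    by_contra hne
    have := not_nonempty_iff.mp hne
    rw [spectrum.of_subsingleton] at hμ
    exact hμ
  let im : Matrix (Fin a) (Fin a) ℝ →L[ℝ] Matrix (Fin a) (Fin a) ℂ :=
    LinearMap.toContinuousLinearMap Complex.ofRealCLM.toLinearMap.mapMatrix
  have hpow (t : ℕ) : (s * ‖μ‖ / r) ^ t ≤ ‖im‖ * c := by
    have hmem := spectrum.norm_le_norm_of_mem (spectrum.pow_mem_pow _ t hμ)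
    have him : M.map (algebraMap ℝ ℂ) ^ t = im (M ^ t) := by
      rw [← Matrix.map_pow]
      ext i j
      simp [im]
    have h₁ : ‖μ‖ ^ t ≤ ‖im‖ * ‖M ^ t‖ := by
      rw [← norm_pow]
      exact hmem.trans (him ▸ im.le_opNorm _)
    have h₂ : s ^ t * ‖M ^ t‖ ≤ c * r ^ t := by
      have := h t
      rwa [smul_pow, norm_smul, Real.norm_of_nonneg (by positivity)] at this
    rw [div_pow, div_le_iff₀ (by positivity), mul_pow]
    calc s ^ t * ‖μ‖ ^ t ≤ s ^ t * (‖im‖ * ‖M ^ t‖) := by gcongr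
      _ = ‖im‖ * (s ^ t * ‖M ^ t‖) := by ring
      _ ≤ ‖im‖ * (c * r ^ t) := by gcongr
      _ = _ := by ring
  rw [le_div_iff₀ hs, mul_comm]
  by_contra! hlt
  obtain ⟨t, ht⟩ := pow_unbounded_of_one_lt (‖im‖ * c) ((one_lt_div hr).mpr hlt)
  exact absurd (hpow t) (not_le.mpr ht)

theorem norm_transpose_pow {a : ℕ} (M : Matrix (Fin a) (Fin a) ℝ) (t : ℕ) :
    ‖Mᵀ ^ t‖ = ‖M ^ t‖ := by
  rw [← transpose_pow, ← conjTranspose_eq_transpose_of_trivial, l2_opNorm_conjTranspose]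

theorem summable_lyapunov {a : ℕ} {M : Matrix (Fin a) (Fin a) ℝ} {c q : ℝ} (hq : 0 ≤ q)
    (hq1 : q < 1) (h : ∀ t : ℕ, ‖M ^ t‖ ≤ c * q ^ t) (W : Matrix (Fin a) (Fin a) ℝ) :
    Summable fun t : ℕ => Mᵀ ^ t * W * M ^ t := by
  have hgeo : Summable fun t : ℕ => c ^ 2 * ‖W‖ * (q ^ 2) ^ t :=
    (summable_geometric_of_lt_one (by positivity) (by nlinarith)).mul_left _
  refine Summable.of_norm_bounded hgeo fun t => ?_
  calc ‖Mᵀ ^ t * W * M ^ t‖ ≤ ‖Mᵀ ^ t‖ * ‖W‖ * ‖M ^ t‖ := norm_mul₃_le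
    _ = ‖M ^ t‖ ^ 2 * ‖W‖ := by rw [norm_transpose_pow]; ring
    _ ≤ (c * q ^ t) ^ 2 * ‖W‖ := by
        gcongr
        exact h t
    _ = _ := by ring

theorem tsum_lyapunov_eq {a : ℕ} {M W : Matrix (Fin a) (Fin a) ℝ}
    (h : Summable fun t : ℕ => Mᵀ ^ t * W * M ^ t) :
    ∑' t : ℕ, Mᵀ ^ t * W * M ^ t = W + Mᵀ * (∑' t : ℕ, Mᵀ ^ t * W * M ^ t) * M := by
  conv_lhs => rw [h.tsum_eq_zero_add]
  rw [← h.tsum_mul_left, ← (h.mul_left _).tsum_mul_right]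
  simp only [pow_zero, one_mul, mul_one]
  congr 1
  refine tsum_congr fun t => ?_
  rw [pow_succ', pow_succ]
  simp only [Matrix.mul_assoc]

theorem isSymm_tsum_lyapunov {a : ℕ} {M W : Matrix (Fin a) (Fin a) ℝ} (hW : W.IsSymm) :
    (∑' t : ℕ, Mᵀ ^ t * W * M ^ t).IsSymm := by
  rw [IsSymm, transpose_tsum]
  refine tsum_congr fun t => ?_
  simp only [transpose_mul, transpose_pow, transpose_transpose, hW.eq, Matrix.mul_assoc]

theorem posSemidef_tsum_lyapunov {a : ℕ} {M W : Matrix (Fin a) (Fin a) ℝ} (hW : W.PosSemidef)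
    (h : Summable fun t : ℕ => Mᵀ ^ t * W * M ^ t) :
    (∑' t : ℕ, Mᵀ ^ t * W * M ^ t).PosSemidef := by
  have hWs : W.IsSymm := by
    simpa [IsSymm, IsHermitian, conjTranspose_eq_transpose_of_trivial] using hW.isHermitian
  refine PosSemidef.of_dotProduct_mulVec_nonneg ?_ fun x => ?_
  · rw [IsHermitian, conjTranspose_eq_transpose_of_trivial]
    exact isSymm_tsum_lyapunov hWs
  · let f : Matrix (Fin a) (Fin a) ℝ →+ ℝ :=
      { toFun := fun X => star x ⬝ᵥ (X *ᵥ x)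
        map_zero' := by simp
        map_add' := fun X Y => by simp [add_mulVec] }
    have hf : Continuous f := by
      change Continuous fun X : Matrix (Fin a) (Fin a) ℝ => star x ⬝ᵥ (X *ᵥ x)
      fun_prop
    change 0 ≤ f _
    rw [← (h.hasSum.map f hf).tsum_eq]
    refine tsum_nonneg fun t => ?_
    change 0 ≤ star x ⬝ᵥ ((Mᵀ ^ t * W * M ^ t) *ᵥ x)
    rw [star_trivial, ← transpose_pow, dotProduct_congruence_mulVec]
    simpa using hW.dotProduct_mulVec_nonneg (M ^ t *ᵥ x)

theorem Pmat_eq_tsum {n m p : ℕ} (A : Matrix (Fin n) (Fin n) ℝ) (B : Matrix (Fin n) (Fin m) ℝ)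
    (C : Matrix (Fin p) (Fin n) ℝ) (Q : Matrix (Fin n) (Fin n) ℝ) (R : Matrix (Fin m) (Fin m) ℝ)
    {γ : ℝ} (hγ : 0 ≤ γ) (K : Matrix (Fin m) (Fin p) ℝ) :
    Pmat A B C Q R γ K = ∑' t : ℕ, (√γ • Acl A B C K)ᵀ ^ t *
      (Q + (K * C)ᵀ * R * (K * C)) * (√γ • Acl A B C K) ^ t := by
  refine tsum_congr fun t => ?_
  rw [transpose_smul, smul_pow, smul_pow, smul_mul_assoc, smul_mul_assoc, mul_smul_comm, smul_smul,
    ← mul_pow, Real.mul_self_sqrt hγ, transpose_mul]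
  simp only [Matrix.mul_assoc]

/-- A quadratic form `d` with `d (M x) = d x - e x`, `M` a contraction for the seminorm `s` and
`|e| ≤ ε s²`, is bounded by the corresponding geometric series. -/
theorem abs_le_of_contraction {E : Type*} {d e s : E → ℝ} {M : E → E} {r ε c : ℝ}
    (hr0 : 0 ≤ r) (hr1 : r < 1) (hε : 0 ≤ ε) (hc : 0 ≤ c) (hs0 : ∀ x, 0 ≤ s x)
    (hd : ∀ x, d x = e x + d (M x)) (he : ∀ x, |e x| ≤ ε * s x ^ 2)
    (hM : ∀ x, s (M x) ≤ r * s x) (hbd : ∀ x, |d x| ≤ c * s x ^ 2) (x : E) :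
    |d x| ≤ ε / (1 - r ^ 2) * s x ^ 2 := by
  have hr2 : 0 < 1 - r ^ 2 := by nlinarith
  have step (k : ℕ) : ∀ x, |d x| ≤ (c * (r ^ 2) ^ k + ε / (1 - r ^ 2)) * s x ^ 2 := by
    induction k with
    | zero =>
      intro x
      have : 0 ≤ ε / (1 - r ^ 2) * s x ^ 2 := by positivity
      simp only [pow_zero, mul_one, add_mul]
      linarith [hbd x]
    | succ k ih =>
      intro x
      calc |d x| ≤ |e x| + |d (M x)| := by rw [hd x]; exact abs_add_le _ _
        _ ≤ ε * s x ^ 2 + (c * (r ^ 2) ^ k + ε / (1 - r ^ 2)) * (r * s x) ^ 2 := by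
            gcongr
            · exact he x
            · refine (ih (M x)).trans ?_
              gcongr
              · exact hs0 _
              · exact hM x
        _ = _ := by field_simp; ring
  have hlim : Tendsto (fun k : ℕ => (c * (r ^ 2) ^ k + ε / (1 - r ^ 2)) * s x ^ 2) atTop
      (𝓝 ((c * 0 + ε / (1 - r ^ 2)) * s x ^ 2)) :=
    (((tendsto_pow_atTop_nhds_zero_of_lt_one (by positivity) (by linarith)).const_mul c).add_const
      _).mul_const _
  simpa using ge_of_tendsto' hlim fun k => step k x

theorem abs_sq_sub_sq_le {u v δ w : ℝ} (hu : 0 ≤ u) (hv : 0 ≤ v) (h : |u - v| ≤ δ) (hw : u + v ≤ w) :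
    |u ^ 2 - v ^ 2| ≤ δ * w := by
  rw [sq_sub_sq, abs_mul, abs_of_nonneg (by positivity : 0 ≤ u + v), mul_comm]
  exact mul_le_mul h hw (by positivity) ((abs_nonneg _).trans h)

theorem abs_norm_mulVec_sub_le {a b : ℕ} (X Y : Matrix (Fin a) (Fin b) ℝ) (x : Fin b → ℝ) :
    |‖WithLp.toLp 2 (X *ᵥ x)‖ - ‖WithLp.toLp 2 (Y *ᵥ x)‖| ≤ ‖WithLp.toLp 2 ((X - Y) *ᵥ x)‖ := by
  rw [sub_mulVec, WithLp.toLp_sub]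
  exact abs_norm_sub_norm_le _ _

theorem le_dotProduct_mulVec_of_posSemidef_sub {a : ℕ} {W : Matrix (Fin a) (Fin a) ℝ} {l : ℝ}
    (h : (W - l • (1 : Matrix (Fin a) (Fin a) ℝ)).PosSemidef) (x : Fin a → ℝ) :
    l * ‖WithLp.toLp 2 x‖ ^ 2 ≤ x ⬝ᵥ (W *ᵥ x) := by
  have := h.dotProduct_mulVec_nonneg x
  simp only [star_trivial, sub_mulVec, smul_mulVec, one_mulVec, dotProduct_sub, dotProduct_smul,
    dotProduct_self_eq_norm_sq, smul_eq_mul] at this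
  linarith

theorem dotProduct_mulVec_le_of_posSemidef_sub {a : ℕ} {W : Matrix (Fin a) (Fin a) ℝ} {l : ℝ}
    (h : (l • (1 : Matrix (Fin a) (Fin a) ℝ) - W).PosSemidef) (x : Fin a → ℝ) :
    x ⬝ᵥ (W *ᵥ x) ≤ l * ‖WithLp.toLp 2 x‖ ^ 2 := by
  have := h.dotProduct_mulVec_nonneg x
  simp only [star_trivial, sub_mulVec, smul_mulVec, one_mulVec, dotProduct_sub, dotProduct_smul,
    dotProduct_self_eq_norm_sq, smul_eq_mul] at this
  linarith

theorem posSemidef_of_posSemidef_sub_smul_one {a : ℕ} {W : Matrix (Fin a) (Fin a) ℝ} {l : ℝ}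
    (hl : 0 ≤ l) (h : (W - l • (1 : Matrix (Fin a) (Fin a) ℝ)).PosSemidef) : W.PosSemidef := by
  simpa using h.add (PosSemidef.one.smul hl)

theorem contraction_of_lyapunov {a : ℕ} {S M W : Matrix (Fin a) (Fin a) ℝ} {l κ : ℝ}
    (hκ : 1 ≤ κ) (hP : Sᵀ * S = W + Mᵀ * (Sᵀ * S) * M)
    (hW : ∀ x, l * ‖WithLp.toLp 2 x‖ ^ 2 ≤ x ⬝ᵥ (W *ᵥ x))
    (hS : ∀ x, ‖WithLp.toLp 2 (S *ᵥ x)‖ ^ 2 ≤ κ ^ 2 * l * ‖WithLp.toLp 2 x‖ ^ 2) (x : Fin a → ℝ) :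
    ‖WithLp.toLp 2 (S *ᵥ (M *ᵥ x))‖ ≤ (1 - 1 / (2 * κ ^ 2)) * ‖WithLp.toLp 2 (S *ᵥ x)‖ := by
  have hx := congrArg (fun X => x ⬝ᵥ (X *ᵥ x)) hP
  simp only [add_mulVec, dotProduct_add, dotProduct_congruence_mulVec, dotProduct_gram_mulVec]
    at hx
  have hκ2 : 1 / (2 * κ ^ 2) ≤ 1 / 2 := by
    gcongr
    nlinarith
  have h₁ : ‖WithLp.toLp 2 (S *ᵥ x)‖ ^ 2 / κ ^ 2 ≤ l * ‖WithLp.toLp 2 x‖ ^ 2 := by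
    rw [div_le_iff₀ (by positivity)]
    linarith [hS x]
  refine le_of_sq_le_sq ?_ (mul_nonneg (by linarith) (norm_nonneg _))
  have h₂ : ((1 - 1 / (2 * κ ^ 2)) * ‖WithLp.toLp 2 (S *ᵥ x)‖) ^ 2 =
      ‖WithLp.toLp 2 (S *ᵥ x)‖ ^ 2 - ‖WithLp.toLp 2 (S *ᵥ x)‖ ^ 2 / κ ^ 2
        + (1 / (2 * κ ^ 2) * ‖WithLp.toLp 2 (S *ᵥ x)‖) ^ 2 := by
    field_simp
    ring
  rw [h₂]
  nlinarith [hW x, sq_nonneg (1 / (2 * κ ^ 2) * ‖WithLp.toLp 2 (S *ᵥ x)‖)]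

theorem norm_pow_le_of_contraction {a : ℕ} {S M : Matrix (Fin a) (Fin a) ℝ} {l κ r : ℝ}
    (hl : 0 < l) (hκ : 0 ≤ κ) (hr : 0 ≤ r)
    (hSl : ∀ x, l * ‖WithLp.toLp 2 x‖ ≤ ‖WithLp.toLp 2 (S *ᵥ x)‖)
    (hSu : ∀ x, ‖WithLp.toLp 2 (S *ᵥ x)‖ ≤ κ * l * ‖WithLp.toLp 2 x‖)
    (hM : ∀ x, ‖WithLp.toLp 2 (S *ᵥ (M *ᵥ x))‖ ≤ r * ‖WithLp.toLp 2 (S *ᵥ x)‖) (t : ℕ) :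
    ‖M ^ t‖ ≤ κ * r ^ t := by
  have key (t : ℕ) : ∀ x, ‖WithLp.toLp 2 (S *ᵥ (M ^ t *ᵥ x))‖ ≤
      r ^ t * ‖WithLp.toLp 2 (S *ᵥ x)‖ := by
    induction t with
    | zero => simp
    | succ t ih =>
      intro x
      rw [pow_succ, ← mulVec_mulVec, pow_succ, mul_assoc]
      exact (ih _).trans (by gcongr; exact hM x)
  refine norm_le_of_forall_mulVec_le (by positivity) fun x => ?_
  refine le_of_mul_le_mul_left ?_ hl
  calc l * ‖WithLp.toLp 2 (M ^ t *ᵥ x)‖ ≤ r ^ t * ‖WithLp.toLp 2 (S *ᵥ x)‖ :=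
        (hSl _).trans (key t x)
    _ ≤ r ^ t * (κ * l * ‖WithLp.toLp 2 x‖) := by gcongr; exact hSu x
    _ = _ := by ring

theorem lyapunov_solution_bounds {a : ℕ} (ha : 1 ≤ a) {S M W : Matrix (Fin a) (Fin a) ℝ} {l ν : ℝ}
    (hl : 0 < l) (hν : 0 < ν) (hP : Sᵀ * S = W + Mᵀ * (Sᵀ * S) * M)
    (hW : ∀ x, l * ‖WithLp.toLp 2 x‖ ^ 2 ≤ x ⬝ᵥ (W *ᵥ x)) (htr : (Sᵀ * S).trace ≤ ν) :
    1 ≤ √(ν / l) ∧ (∀ x, √l * ‖WithLp.toLp 2 x‖ ≤ ‖WithLp.toLp 2 (S *ᵥ x)‖) ∧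
      (∀ x, x ⬝ᵥ (W *ᵥ x) ≤ ‖WithLp.toLp 2 (S *ᵥ x)‖ ^ 2) ∧
      ∀ x, ‖WithLp.toLp 2 (S *ᵥ x)‖ ≤ √(ν / l) * √l * ‖WithLp.toLp 2 x‖ := by
  have h₁ (x) : x ⬝ᵥ (W *ᵥ x) ≤ ‖WithLp.toLp 2 (S *ᵥ x)‖ ^ 2 := by
    have hx := congrArg (fun X => x ⬝ᵥ (X *ᵥ x)) hP
    simp only [add_mulVec, dotProduct_add, dotProduct_congruence_mulVec, dotProduct_gram_mulVec]
      at hx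
    rw [hx]
    exact le_add_of_nonneg_right (by positivity)
  have h₂ (x : Fin a → ℝ) : ‖WithLp.toLp 2 (S *ᵥ x)‖ ^ 2 ≤ ν * ‖WithLp.toLp 2 x‖ ^ 2 :=
    (norm_gram_mulVec_sq_le_trace S x).trans (by gcongr)
  refine ⟨?_, fun x => ?_, h₁, fun x => ?_⟩
  · rw [Real.one_le_sqrt, one_le_div hl]
    have := ((hW (Pi.single ⟨0, ha⟩ 1)).trans (h₁ _)).trans (h₂ _)
    simpa using this
  · refine le_of_sq_le_sq ?_ (norm_nonneg _)
    rw [mul_pow, Real.sq_sqrt hl.le]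
    exact (hW x).trans (h₁ x)
  · refine le_of_sq_le_sq ?_ (by positivity)
    rw [← Real.sqrt_mul (by positivity), div_mul_cancel₀ _ hl.ne', mul_pow, Real.sq_sqrt hν.le]
    exact h₂ x

theorem lyapunov_constant_bound {κ l₀ l₁ ψ φ d : ℝ} (hκ : 1 ≤ κ) (hl₀ : 0 < l₀) (hl : l₀ ≤ l₁)
    (hψ : 1 ≤ ψ) (hφ : 1 ≤ φ) (hd : 0 ≤ d) (hd' : d ≤ 1 / (8 * κ ^ 3 * ψ * φ)) :
    (√(l₁ / l₀) * φ * d * (2 + √(l₁ / l₀) * φ * d) + κ * (ψ * φ * d) * 2) /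
        (1 - (1 - 3 / 8 * (1 / κ ^ 2)) ^ 2) * (κ ^ 2 * l₀) ≤
      16 * κ ^ 7 * l₁ * ψ * φ * d := by
  set σ := √(l₁ / l₀) with hσ
  have hσ2 : σ ^ 2 * l₀ = l₁ := by
    rw [hσ, Real.sq_sqrt (div_nonneg (hl₀.le.trans hl) hl₀.le), div_mul_cancel₀ _ hl₀.ne']
  have hσ1 : 1 ≤ σ := by rwa [hσ, Real.one_le_sqrt, one_le_div hl₀]
  have hκ2 : 1 / κ ^ 2 ≤ 1 := by
    rw [div_le_one (by positivity)]
    nlinarith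
  have hη : 0 < 1 / κ ^ 2 := by positivity
  have hden : 1 / κ ^ 2 / 2 ≤ 1 - (1 - 3 / 8 * (1 / κ ^ 2)) ^ 2 := by nlinarith
  have hφd : φ * d ≤ 1 / 8 := by
    rw [le_div_iff₀ (by positivity)] at hd'
    have : 1 ≤ κ ^ 3 * ψ := one_le_mul_of_one_le_of_one_le (one_le_pow₀ hκ) hψ
    nlinarith [mul_nonneg (by positivity : 0 ≤ φ * d) (sub_nonneg.mpr this)]
  have hσl : σ * l₀ ≤ l₁ := by nlinarith
  have hφd0 : 0 ≤ φ * d := by positivity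
  have hl₁ : 0 < l₁ := hl₀.trans_le hl
  set ε := σ * φ * d * (2 + σ * φ * d) + κ * (ψ * φ * d) * 2 with hε
  have hε0 : 0 ≤ ε := by positivity
  have hεl : ε * l₀ ≤ 5 * κ * (l₁ * ψ * φ * d) := by
    have e₁ : ε * l₀ = 2 * (σ * l₀) * (φ * d) + σ ^ 2 * l₀ * (φ * d) * (φ * d)
        + 2 * l₀ * (κ * ψ) * (φ * d) := by rw [hε]; ring
    have hκψ : 1 ≤ κ * ψ := one_le_mul_of_one_le_of_one_le hκ hψ
    have e₂ : 2 * (σ * l₀) * (φ * d) ≤ 2 * l₁ * (κ * ψ) * (φ * d) := by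
      calc 2 * (σ * l₀) * (φ * d) ≤ 2 * l₁ * 1 * (φ * d) := by rw [mul_one]; gcongr
        _ ≤ _ := by gcongr
    have e₃ : σ ^ 2 * l₀ * (φ * d) * (φ * d) ≤ l₁ * (κ * ψ) * (φ * d) := by
      rw [hσ2]
      exact mul_le_mul_of_nonneg_right (mul_le_mul_of_nonneg_left (by linarith) hl₁.le) hφd0
    have e₄ : 2 * l₀ * (κ * ψ) * (φ * d) ≤ 2 * l₁ * (κ * ψ) * (φ * d) := by gcongr
    linarith
  calc ε / (1 - (1 - 3 / 8 * (1 / κ ^ 2)) ^ 2) * (κ ^ 2 * l₀)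
      ≤ ε / (1 / κ ^ 2 / 2) * (κ ^ 2 * l₀) := by gcongr
    _ = 2 * κ ^ 4 * (ε * l₀) := by field_simp
    _ ≤ 2 * κ ^ 4 * (5 * κ * (l₁ * ψ * φ * d)) := by gcongr
    _ = 10 * κ ^ 5 * (l₁ * ψ * φ * d) := by ring
    _ ≤ 16 * κ ^ 7 * (l₁ * ψ * φ * d) := by
        gcongr
        · norm_num
        · norm_num
    _ = _ := by ring

/-- Perturbation of the quadratic form of a Lyapunov equation by a pair `(L', M')`. -/
theorem abs_lyapunov_residual_le {a b : ℕ} {S M M' : Matrix (Fin a) (Fin a) ℝ}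
    {T : Matrix (Fin b) (Fin b) ℝ} {L L' : Matrix (Fin b) (Fin a) ℝ} {α β : ℝ} (x : Fin a → ℝ)
    (hTL : ‖WithLp.toLp 2 (T *ᵥ (L *ᵥ x))‖ ≤ ‖WithLp.toLp 2 (S *ᵥ x)‖)
    (hTL' : ‖WithLp.toLp 2 (T *ᵥ ((L' - L) *ᵥ x))‖ ≤ α * ‖WithLp.toLp 2 (S *ᵥ x)‖)
    (hM : ‖WithLp.toLp 2 (S *ᵥ (M *ᵥ x))‖ ≤ ‖WithLp.toLp 2 (S *ᵥ x)‖)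
    (hM' : ‖WithLp.toLp 2 (S *ᵥ (M' *ᵥ x))‖ ≤ ‖WithLp.toLp 2 (S *ᵥ x)‖)
    (hMM' : ‖WithLp.toLp 2 (S *ᵥ ((M' - M) *ᵥ x))‖ ≤ β * ‖WithLp.toLp 2 (S *ᵥ x)‖) :
    |x ⬝ᵥ ((L'ᵀ * (Tᵀ * T) * L' - Lᵀ * (Tᵀ * T) * L
        + (M'ᵀ * (Sᵀ * S) * M' - Mᵀ * (Sᵀ * S) * M)) *ᵥ x)| ≤
      (α * (2 + α) + β * 2) * ‖WithLp.toLp 2 (S *ᵥ x)‖ ^ 2 := by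
  simp only [add_mulVec, sub_mulVec, dotProduct_add, dotProduct_sub, dotProduct_congruence_mulVec,
    dotProduct_gram_mulVec]
  have h₁ : |‖WithLp.toLp 2 (T *ᵥ (L' *ᵥ x))‖ - ‖WithLp.toLp 2 (T *ᵥ (L *ᵥ x))‖| ≤
      α * ‖WithLp.toLp 2 (S *ᵥ x)‖ := by
    have := abs_norm_mulVec_sub_le (T * L') (T * L) x
    rw [← Matrix.mul_sub] at this
    simp only [← mulVec_mulVec] at this
    exact this.trans hTL'
  have h₂ : |‖WithLp.toLp 2 (S *ᵥ (M' *ᵥ x))‖ - ‖WithLp.toLp 2 (S *ᵥ (M *ᵥ x))‖| ≤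
      β * ‖WithLp.toLp 2 (S *ᵥ x)‖ := by
    have := abs_norm_mulVec_sub_le (S * M') (S * M) x
    rw [← Matrix.mul_sub] at this
    simp only [← mulVec_mulVec] at this
    exact this.trans hMM'
  have h₃ := abs_sq_sub_sq_le (norm_nonneg _) (norm_nonneg _) h₁
    (w := (2 + α) * ‖WithLp.toLp 2 (S *ᵥ x)‖) (by linarith [(abs_le.mp h₁).2])
  have h₄ := abs_sq_sub_sq_le (norm_nonneg _) (norm_nonneg _) h₂
    (w := 2 * ‖WithLp.toLp 2 (S *ᵥ x)‖) (by linarith)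
  refine (abs_add_le _ _).trans ((add_le_add h₃ h₄).trans_eq ?_)
  ring

end Auxiliary

open scoped Matrix.Norms.L2Operator in
/-- local Lipschitz continuity of `K ↦ P_K(γ)` on `S_γ(ν)`. -/
theorem stmt3
    {n m p : ℕ} (hn : 1 ≤ n) (hm : 1 ≤ m) (hp : 1 ≤ p)
    (A : Matrix (Fin n) (Fin n) ℝ) (B : Matrix (Fin n) (Fin m) ℝ) (C : Matrix (Fin p) (Fin n) ℝ)
    (Q : Matrix (Fin n) (Fin n) ℝ) (R : Matrix (Fin m) (Fin m) ℝ)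
    (hQsymm : Q.IsSymm) (hRsymm : R.IsSymm)
    (ℓ₀ ℓ₁ ψ φ : ℝ) (hℓ₀ : 0 < ℓ₀) (hℓ₀₁ : ℓ₀ ≤ ℓ₁) (hψ : 1 ≤ ψ) (hφ : 1 ≤ φ)
    (hQlb : (Q - ℓ₀ • (1 : Matrix (Fin n) (Fin n) ℝ)).PosSemidef)
    (hQub : (ℓ₁ • (1 : Matrix (Fin n) (Fin n) ℝ) - Q).PosSemidef)
    (hRlb : (R - ℓ₀ • (1 : Matrix (Fin m) (Fin m) ℝ)).PosSemidef)
    (hRub : (ℓ₁ • (1 : Matrix (Fin m) (Fin m) ℝ) - R).PosSemidef)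
    (hB : spNorm B ≤ ψ) (hC : spNorm C ≤ φ)
    (γ : ℝ) (hγ : γ ∈ Set.Ioc (0 : ℝ) 1) (ν : ℝ) (hν : 0 < ν)
    (K K' : Matrix (Fin m) (Fin p) ℝ)
    (hK : inS A B C γ K) (hKν : Jcost A B C Q R γ K ≤ ν)
    (hKK' : spNorm (K - K') ≤ 1 / (8 * Real.sqrt (ν / ℓ₀) ^ 3 * ψ * φ)) :
    inS A B C γ K' ∧
      spNorm (Pmat A B C Q R γ K - Pmat A B C Q R γ K') ≤
        16 * Real.sqrt (ν / ℓ₀) ^ 7 * ℓ₁ * ψ * φ * spNorm (K - K') := by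
  have hγ0 := hγ.1
  have hsγ0 : 0 < √γ := Real.sqrt_pos.mpr hγ0
  have hsγ1 : √γ ≤ 1 := Real.sqrt_le_one.mpr hγ.2
  have hRpsd := posSemidef_of_posSemidef_sub_smul_one hℓ₀.le hRlb
  obtain ⟨T, hT⟩ := exists_eq_gram hRpsd
  set κ := √(ν / ℓ₀) with hκdef
  set d := spNorm (K - K') with hd
  have hd0 : 0 ≤ d := norm_nonneg _
  set M := √γ • Acl A B C K with hM
  set M' := √γ • Acl A B C K' with hM'
  set W := Q + (K * C)ᵀ * R * (K * C) with hW
  set W' := Q + (K' * C)ᵀ * R * (K' * C) with hW'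
  obtain ⟨c₀, q₀, hq₀, hq₀1, hpow⟩ := exists_norm_pow_le_of_specRad_lt hn _ hsγ0.le hK
  have hsum := summable_lyapunov hq₀ hq₀1 hpow W
  have hWx (x) : x ⬝ᵥ (W *ᵥ x) = x ⬝ᵥ (Q *ᵥ x) + ‖WithLp.toLp 2 (T *ᵥ ((K * C) *ᵥ x))‖ ^ 2 := by
    rw [hW, hT, add_mulVec, dotProduct_add, dotProduct_congruence_mulVec, dotProduct_gram_mulVec]
  have hWlb (x) : ℓ₀ * ‖WithLp.toLp 2 x‖ ^ 2 ≤ x ⬝ᵥ (W *ᵥ x) := by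
    rw [hWx]
    exact (le_dotProduct_mulVec_of_posSemidef_sub hQlb x).trans
      (le_add_of_nonneg_right (by positivity))
  have hWpsd : W.PosSemidef := by
    have := hRpsd.conjTranspose_mul_mul_same (K * C)
    rw [conjTranspose_eq_transpose_of_trivial] at this
    exact (posSemidef_of_posSemidef_sub_smul_one hℓ₀.le hQlb).add this
  have hPeq : Pmat A B C Q R γ K = _ := Pmat_eq_tsum A B C Q R hγ0.le K
  have hP'eq : Pmat A B C Q R γ K' = _ := Pmat_eq_tsum A B C Q R hγ0.le K'
  have hPpsd := posSemidef_tsum_lyapunov hWpsd hsum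
  have hPlyap := tsum_lyapunov_eq hsum
  rw [← hPeq] at hPpsd hPlyap
  rw [← hM] at hPlyap
  obtain ⟨S, hS⟩ := exists_eq_gram hPpsd
  rw [Jcost, hS] at hKν
  have hSlyap := hPlyap
  rw [hS] at hSlyap
  obtain ⟨hκ, hSl, hWS, hSu⟩ := lyapunov_solution_bounds hn hℓ₀ hν hSlyap hWlb hKν
  rw [← hκdef] at hκ hSu
  have hνκ : κ ^ 2 * ℓ₀ = ν := by
    rw [hκdef, Real.sq_sqrt (by positivity), div_mul_cancel₀ _ hℓ₀.ne']
  have hSu2 (x) : ‖WithLp.toLp 2 (S *ᵥ x)‖ ^ 2 ≤ κ ^ 2 * ℓ₀ * ‖WithLp.toLp 2 x‖ ^ 2 := by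
    rw [hνκ]
    exact (norm_gram_mulVec_sq_le_trace S x).trans (by gcongr)
  have hκ0 : 0 < κ := by linarith
  have hsl0 : 0 < √ℓ₀ := Real.sqrt_pos.mpr hℓ₀
  have hη : 0 < 1 / κ ^ 2 := by positivity
  have hη1 : 1 / κ ^ 2 ≤ 1 := by
    rw [div_le_one (by positivity)]
    nlinarith
  set r := 1 - 3 / 8 * (1 / κ ^ 2) with hr
  have hr0 : 0 < r := by linarith
  have hr1 : r < 1 := by linarith
  have hMc (x : Fin n → ℝ) : ‖WithLp.toLp 2 (S *ᵥ (M *ᵥ x))‖ ≤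
      (1 - 1 / (2 * κ ^ 2)) * ‖WithLp.toLp 2 (S *ᵥ x)‖ :=
    contraction_of_lyapunov hκ hSlyap hWlb hSu2 x
  have hΔ : ‖M' - M‖ ≤ ψ * φ * d := by
    have : M' - M = √γ • (B * (K - K') * C) := by
      simp only [hM, hM', Acl, Matrix.mul_sub, Matrix.sub_mul, smul_sub]
      abel
    rw [this, norm_smul, Real.norm_of_nonneg hsγ0.le]
    calc √γ * ‖B * (K - K') * C‖ ≤ 1 * (ψ * d * φ) := by
          gcongr
          refine (l2_opNorm_mul _ _).trans ?_
          gcongr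
          · exact (l2_opNorm_mul _ _).trans
              (mul_le_mul hB le_rfl (norm_nonneg _) (by linarith))
          · exact hC
      _ = _ := by ring
  have hSΔ (x : Fin n → ℝ) : ‖WithLp.toLp 2 (S *ᵥ ((M' - M) *ᵥ x))‖ ≤
      κ * (ψ * φ * d) * ‖WithLp.toLp 2 (S *ᵥ x)‖ := by
    calc _ ≤ κ * √ℓ₀ * ‖WithLp.toLp 2 ((M' - M) *ᵥ x)‖ := hSu _
      _ ≤ κ * √ℓ₀ * (ψ * φ * d * ‖WithLp.toLp 2 x‖) := by
          gcongr
          exact (norm_mulVec_le _ _).trans (by gcongr)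
      _ = κ * (ψ * φ * d) * (√ℓ₀ * ‖WithLp.toLp 2 x‖) := by ring
      _ ≤ _ := by gcongr; exact hSl x
  have hκΔ : κ * (ψ * φ * d) ≤ 1 / 8 * (1 / κ ^ 2) := by
    rw [le_div_iff₀ (by positivity)] at hKK'
    rw [← mul_div_assoc, le_div_iff₀ (by positivity)]
    linarith
  have hM'c (x : Fin n → ℝ) : ‖WithLp.toLp 2 (S *ᵥ (M' *ᵥ x))‖ ≤
      r * ‖WithLp.toLp 2 (S *ᵥ x)‖ := by
    have h₁ := abs_norm_mulVec_sub_le (S * M') (S * M) x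
    rw [← Matrix.mul_sub] at h₁
    simp only [← mulVec_mulVec] at h₁
    have h₂ : κ * (ψ * φ * d) * ‖WithLp.toLp 2 (S *ᵥ x)‖ ≤
        1 / 8 * (1 / κ ^ 2) * ‖WithLp.toLp 2 (S *ᵥ x)‖ := by gcongr
    have h₃ : r = 1 - 1 / (2 * κ ^ 2) + 1 / 8 * (1 / κ ^ 2) := by
      rw [hr]
      field_simp
      ring
    rw [h₃, add_mul]
    linarith [(abs_le.mp h₁).2, hMc x, hSΔ x]
  have hpow' := norm_pow_le_of_contraction hsl0 hκ0.le hr0.le hSl hSu hM'c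
  refine ⟨(specRad_le_of_norm_pow_le _ hsγ0 hr0 hpow').trans_lt hr1, ?_⟩
  have hP'lyap := tsum_lyapunov_eq (summable_lyapunov hr0.le hr1 hpow' W')
  rw [← hP'eq] at hP'lyap
  have hsymm (L : Matrix (Fin m) (Fin n) ℝ) : (Q + Lᵀ * R * L).IsSymm := by
    rw [IsSymm, transpose_add, transpose_mul, transpose_mul, transpose_transpose, hQsymm.eq,
      hRsymm.eq, Matrix.mul_assoc]
  have hDsymm : (Pmat A B C Q R γ K - Pmat A B C Q R γ K').IsSymm := by
    rw [hPeq, hP'eq]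
    exact (isSymm_tsum_lyapunov (hsymm _)).sub (isSymm_tsum_lyapunov (hsymm _))
  set σ := √(ℓ₁ / ℓ₀) with hσ
  have hσl : σ * √ℓ₀ = √ℓ₁ := by
    rw [hσ, ← Real.sqrt_mul (div_nonneg (hℓ₀.le.trans hℓ₀₁) hℓ₀.le), div_mul_cancel₀ _ hℓ₀.ne']
  have hTu (y : Fin m → ℝ) : ‖WithLp.toLp 2 (T *ᵥ y)‖ ≤ √ℓ₁ * ‖WithLp.toLp 2 y‖ := by
    refine le_of_sq_le_sq ?_ (by positivity)
    rw [← dotProduct_gram_mulVec, ← hT, mul_pow, Real.sq_sqrt (hℓ₀.le.trans hℓ₀₁)]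
    exact dotProduct_mulVec_le_of_posSemidef_sub hRub y
  have hTL (x : Fin n → ℝ) : ‖WithLp.toLp 2 (T *ᵥ ((K * C) *ᵥ x))‖ ≤
      ‖WithLp.toLp 2 (S *ᵥ x)‖ := by
    refine le_of_sq_le_sq ?_ (norm_nonneg _)
    have h₁ := hWS x
    have h₂ : 0 ≤ x ⬝ᵥ (Q *ᵥ x) := le_trans (by positivity)
      (le_dotProduct_mulVec_of_posSemidef_sub hQlb x)
    rw [hWx] at h₁
    linarith
  have hTΔ (x : Fin n → ℝ) : ‖WithLp.toLp 2 (T *ᵥ ((K' * C - K * C) *ᵥ x))‖ ≤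
      σ * φ * d * ‖WithLp.toLp 2 (S *ᵥ x)‖ := by
    have hn' : ‖K' * C - K * C‖ ≤ d * φ := by
      rw [← Matrix.sub_mul]
      refine (l2_opNorm_mul _ _).trans (mul_le_mul ?_ hC (norm_nonneg _) hd0)
      rw [norm_sub_rev]
      exact le_rfl
    calc _ ≤ √ℓ₁ * (d * φ * ‖WithLp.toLp 2 x‖) :=
          (hTu _).trans (by gcongr; exact (norm_mulVec_le _ _).trans (by gcongr))
      _ = σ * φ * d * (√ℓ₀ * ‖WithLp.toLp 2 x‖) := by rw [← hσl]; ring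
      _ ≤ _ := by gcongr; exact hSl x
  have hres (x : Fin n → ℝ) := abs_lyapunov_residual_le x (hTL x) (hTΔ x)
    ((hMc x).trans (mul_le_of_le_one_left (norm_nonneg _) (sub_le_self _ (by positivity))))
    ((hM'c x).trans (mul_le_of_le_one_left (norm_nonneg _) hr1.le)) (hSΔ x)
  rw [← hT, ← hS] at hres
  set E := (K' * C)ᵀ * R * (K' * C) - (K * C)ᵀ * R * (K * C) +
    (M'ᵀ * Pmat A B C Q R γ K * M' - Mᵀ * Pmat A B C Q R γ K * M) with hE
  set D := Pmat A B C Q R γ K - Pmat A B C Q R γ K' with hD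
  have hDE : D = -E + M'ᵀ * D * M' := by
    have h₁ : M'ᵀ * D * M' = M'ᵀ * Pmat A B C Q R γ K * M' - M'ᵀ * Pmat A B C Q R γ K' * M' := by
      rw [hD, Matrix.mul_sub, Matrix.sub_mul]
    rw [h₁, hE]
    conv_lhs => rw [hD, hPlyap, hP'lyap, hW, hW']
    abel
  have hDx (x : Fin n → ℝ) : |x ⬝ᵥ (D *ᵥ x)| ≤ ‖D‖ / ℓ₀ * ‖WithLp.toLp 2 (S *ᵥ x)‖ ^ 2 := by
    have h₁ : |x ⬝ᵥ (D *ᵥ x)| ≤ ‖D‖ * ‖WithLp.toLp 2 x‖ ^ 2 := by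
      have h := abs_real_inner_le_norm (WithLp.toLp 2 (D *ᵥ x)) (WithLp.toLp 2 x)
      rw [EuclideanSpace.inner_toLp_toLp, star_trivial] at h
      refine h.trans ?_
      rw [sq, ← mul_assoc]
      gcongr
      exact norm_mulVec_le D x
    refine h₁.trans ?_
    rw [div_mul_eq_mul_div, mul_div_assoc]
    gcongr
    rw [le_div_iff₀ hℓ₀, mul_comm]
    exact (hWlb x).trans (hWS x)
  have hε0 : 0 ≤ σ * φ * d * (2 + σ * φ * d) + κ * (ψ * φ * d) * 2 := by positivity
  have hbound := lyapunov_constant_bound hκ hℓ₀ hℓ₀₁ hψ hφ hd0 hKK'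
  have hr2 : 0 < 1 - r ^ 2 := by nlinarith
  refine le_trans ?_ hbound
  refine norm_le_of_abs_dotProduct_mulVec_le hDsymm (by positivity) fun x => ?_
  have hfin := abs_le_of_contraction (d := fun x => x ⬝ᵥ (D *ᵥ x)) (e := fun x => x ⬝ᵥ (-E *ᵥ x))
    (s := fun x => ‖WithLp.toLp 2 (S *ᵥ x)‖) (M := fun x => M' *ᵥ x) hr0.le hr1 hε0
    (by positivity : 0 ≤ ‖D‖ / ℓ₀) (fun x => norm_nonneg _)
    (fun x => by
      conv_lhs => rw [hDE]
      rw [add_mulVec, dotProduct_add, dotProduct_congruence_mulVec])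
    (fun x => by
      rw [neg_mulVec, dotProduct_neg, abs_neg]
      exact hres x) hM'c hDx x
  refine hfin.trans ?_
  rw [mul_assoc (_ / _)]
  gcongr
  exact hSu2 x
end

section
/- Let γ ∈ (0,1], ν > 0, and K ∈ S_γ(ν). Then ‖∇J_γ(K)‖_F ≤ G⁰, where G⁰ = 2κ³φ(ℓ₁ + ψν)·√(min{m,p}). -/
open Matrix

open scoped MatrixOrder Matrix.Norms.L2Operator in
lemma exists_eq_transpose_mul_self_of_posSemidef {a : ℕ} {W : Matrix (Fin a) (Fin a) ℝ}
    (hW : W.PosSemidef) : ∃ Y : Matrix (Fin a) (Fin a) ℝ, W = Yᵀ * Y := by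
  obtain ⟨Y, hY⟩ := CStarAlgebra.nonneg_iff_eq_star_mul_self.mp hW.nonneg
  exact ⟨Y, by simpa [Matrix.star_eq_conjTranspose] using hY⟩

lemma posSemidef_of_sub_smul_one {a : ℕ} {W : Matrix (Fin a) (Fin a) ℝ} {l : ℝ} (hl : 0 < l)
    (hW : (W - l • (1 : Matrix (Fin a) (Fin a) ℝ)).PosSemidef) : W.PosSemidef := by
  simpa using hW.add (Matrix.PosSemidef.one.smul hl.le)

section FrobeniusBounds

open scoped Matrix.Norms.Frobenius

lemma frobNorm_eq_norm {a b : ℕ} (M : Matrix (Fin a) (Fin b) ℝ) : frobNorm M = ‖M‖ := by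
  simp [frobNorm, Matrix.frobenius_norm_def, Real.sqrt_eq_rpow]

lemma norm_sq_eq_trace {a b : ℕ} (M : Matrix (Fin a) (Fin b) ℝ) :
    ‖M‖ ^ 2 = (Mᵀ * M).trace := by
  rw [← frobNorm_eq_norm, frobNorm, Real.sq_sqrt (by positivity), Finset.sum_comm]
  simp [Matrix.trace, Matrix.mul_apply, sq]

lemma trace_congr_nonneg {a b : ℕ} {W : Matrix (Fin a) (Fin a) ℝ} (hW : W.PosSemidef)
    (N : Matrix (Fin a) (Fin b) ℝ) : 0 ≤ (Nᵀ * W * N).trace := by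
  simpa using (hW.conjTranspose_mul_mul_same N).trace_nonneg

lemma mul_norm_sq_le_trace {a b : ℕ} {W : Matrix (Fin a) (Fin a) ℝ} {l : ℝ}
    (hW : (W - l • (1 : Matrix (Fin a) (Fin a) ℝ)).PosSemidef) (N : Matrix (Fin a) (Fin b) ℝ) :
    l * ‖N‖ ^ 2 ≤ (Nᵀ * W * N).trace := by
  have h := trace_congr_nonneg hW N
  rw [Matrix.mul_sub, Matrix.sub_mul, Matrix.trace_sub] at h
  simp only [Matrix.mul_smul, Matrix.smul_mul, Matrix.mul_one, Matrix.trace_smul,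
    smul_eq_mul] at h
  rw [norm_sq_eq_trace]
  linarith

lemma trace_le_mul_norm_sq {a b : ℕ} {W : Matrix (Fin a) (Fin a) ℝ} {l : ℝ}
    (hW : (l • (1 : Matrix (Fin a) (Fin a) ℝ) - W).PosSemidef) (N : Matrix (Fin a) (Fin b) ℝ) :
    (Nᵀ * W * N).trace ≤ l * ‖N‖ ^ 2 := by
  have h := trace_congr_nonneg hW N
  rw [Matrix.mul_sub, Matrix.sub_mul, Matrix.trace_sub] at h
  simp only [Matrix.mul_smul, Matrix.smul_mul, Matrix.mul_one, Matrix.trace_smul,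
    smul_eq_mul] at h
  rw [norm_sq_eq_trace]
  linarith

lemma norm_le_trace_of_posSemidef {a : ℕ} {W : Matrix (Fin a) (Fin a) ℝ} (hW : W.PosSemidef) :
    ‖W‖ ≤ W.trace := by
  obtain ⟨Y, rfl⟩ := exists_eq_transpose_mul_self_of_posSemidef hW
  calc ‖Yᵀ * Y‖ ≤ ‖Yᵀ‖ * ‖Y‖ := Matrix.frobenius_norm_mul _ _
    _ = ‖Y‖ ^ 2 := by rw [Matrix.frobenius_norm_transpose, sq]
    _ = _ := norm_sq_eq_trace Y

lemma norm_mul_le_of_posSemidef {a b : ℕ} {W : Matrix (Fin a) (Fin a) ℝ} {l : ℝ} (hl : 0 < l)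
    (hW : W.PosSemidef) (hWl : (l • (1 : Matrix (Fin a) (Fin a) ℝ) - W).PosSemidef)
    (N : Matrix (Fin a) (Fin b) ℝ) : ‖W * N‖ ≤ l * ‖N‖ := by
  have hWt : Wᵀ = W := by simpa using hW.isHermitian.eq
  have hsq : (l ^ 2 • (1 : Matrix (Fin a) (Fin a) ℝ) - W * W).PosSemidef := by
    have h1 := hWl.conjTranspose_mul_mul_same W
    have h2 := hW.conjTranspose_mul_mul_same (l • (1 : Matrix (Fin a) (Fin a) ℝ) - W)
    have h3 := ((h1.add h2).smul (inv_nonneg.2 hl.le)).add (hWl.smul hl.le)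
    convert h3 using 1
    simp only [Matrix.conjTranspose_eq_transpose_of_trivial, Matrix.transpose_sub,
      Matrix.transpose_smul, Matrix.transpose_one, hWt]
    simp only [Matrix.mul_sub, Matrix.sub_mul, Matrix.mul_smul, Matrix.smul_mul, Matrix.mul_one,
      Matrix.one_mul, smul_sub, smul_add, smul_smul, Matrix.mul_assoc, inv_mul_cancel₀ hl.ne',
      inv_mul_cancel_left₀ hl.ne', one_smul]
    rw [sq]
    abel
  have h := trace_le_mul_norm_sq hsq N
  refine (pow_le_pow_iff_left₀ (by positivity) (by positivity) two_ne_zero).1 ?_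
  rw [norm_sq_eq_trace, Matrix.transpose_mul, hWt, mul_pow]
  simpa only [Matrix.mul_assoc] using h

lemma norm_mul_le_spNorm {a b c : ℕ} (M : Matrix (Fin a) (Fin b) ℝ)
    (N : Matrix (Fin b) (Fin c) ℝ) : ‖M * N‖ ≤ spNorm M * ‖N‖ := by
  have hM : 0 ≤ spNorm M := norm_nonneg _
  refine (pow_le_pow_iff_left₀ (by positivity) (by positivity) two_ne_zero).1 ?_
  rw [mul_pow, ← frobNorm_eq_norm, ← frobNorm_eq_norm, frobNorm, frobNorm,
    Real.sq_sqrt (by positivity), Real.sq_sqrt (by positivity), Finset.sum_comm,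
    Finset.sum_comm (s := (Finset.univ : Finset (Fin b))), Finset.mul_sum]
  refine Finset.sum_le_sum fun j _ => ?_
  have h := (LinearMap.toContinuousLinearMap (Matrix.toEuclideanLin M)).le_opNorm
    (WithLp.toLp 2 (fun i => N i j))
  have h2 := pow_le_pow_left₀ (norm_nonneg _) h 2
  rw [mul_pow, EuclideanSpace.norm_sq_eq, EuclideanSpace.norm_sq_eq] at h2
  simpa [Matrix.mul_apply, Matrix.mulVec, dotProduct, spNorm] using h2

lemma spNorm_transpose {a b : ℕ} (M : Matrix (Fin a) (Fin b) ℝ) : spNorm Mᵀ = spNorm M := by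
  have h := Matrix.l2_opNorm_conjTranspose M
  rw [Matrix.conjTranspose_eq_transpose_of_trivial] at h
  exact h

lemma norm_mul_transpose_le_spNorm {a b c : ℕ} (M : Matrix (Fin a) (Fin b) ℝ)
    (N : Matrix (Fin c) (Fin b) ℝ) : ‖N * Mᵀ‖ ≤ spNorm M * ‖N‖ := by
  rw [← Matrix.frobenius_norm_transpose, Matrix.transpose_mul, Matrix.transpose_transpose,
    ← Matrix.frobenius_norm_transpose N]
  exact norm_mul_le_spNorm M Nᵀ

lemma spectralRadius_le_specRad {n : ℕ} (M : Matrix (Fin n) (Fin n) ℝ) :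
    spectralRadius ℂ (M.map (algebraMap ℝ ℂ)) ≤ ENNReal.ofReal (specRad M) := by
  refine iSup₂_le fun k hk => ?_
  rw [← ENNReal.ofReal_coe_nnreal, coe_nnnorm]
  refine ENNReal.ofReal_le_ofReal (le_csSup ⟨‖M.map (algebraMap ℝ ℂ)‖ *
    ‖(1 : Matrix (Fin n) (Fin n) ℂ)‖, ?_⟩ ⟨k, hk, rfl⟩)
  rintro _ ⟨l, hl, rfl⟩
  exact spectrum.norm_le_norm_mul_of_mem hl

lemma specRad_nonneg {n : ℕ} (M : Matrix (Fin n) (Fin n) ℝ) : 0 ≤ specRad M :=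
  Real.sSup_nonneg (by rintro _ ⟨_, _, rfl⟩; exact norm_nonneg _)

lemma eventually_norm_pow_le_of_specRad_lt {n : ℕ} (M : Matrix (Fin n) (Fin n) ℝ) {s : ℝ}
    (hs : specRad M < s) : ∀ᶠ t : ℕ in Filter.atTop, ‖M ^ t‖ ≤ s ^ t := by
  have hs0 : 0 < s := (specRad_nonneg M).trans_lt hs
  have hlt : spectralRadius ℂ (M.map (algebraMap ℝ ℂ)) < ENNReal.ofReal s :=
    (spectralRadius_le_specRad M).trans_lt ((ENNReal.ofReal_lt_ofReal_iff hs0).2 hs)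
  have hG := spectrum.pow_norm_pow_one_div_tendsto_nhds_spectralRadius (M.map (algebraMap ℝ ℂ))
  filter_upwards [hG.eventually_lt_const hlt, Filter.eventually_gt_atTop 0] with t ht ht0
  have h1 := (ENNReal.ofReal_lt_ofReal_iff hs0).1 ht
  have hmap : ‖(M.map (algebraMap ℝ ℂ)) ^ t‖ = ‖M ^ t‖ := by
    rw [← Matrix.map_pow]
    exact Matrix.frobenius_norm_map_eq _ _ (by simp)
  rw [hmap] at h1
  have h2 := pow_le_pow_left₀ (by positivity) h1.le t
  rwa [one_div, Real.rpow_inv_natCast_pow (norm_nonneg _) ht0.ne'] at h2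

lemma summable_pow_mul_norm_pow_sq {n : ℕ} {M : Matrix (Fin n) (Fin n) ℝ} {γ : ℝ} (hγ : 0 < γ)
    (hM : Real.sqrt γ * specRad M < 1) : Summable fun t : ℕ => γ ^ t * ‖M ^ t‖ ^ 2 := by
  have hg : 0 < Real.sqrt γ := Real.sqrt_pos.2 hγ
  obtain ⟨s, hMs, hs⟩ := exists_between ((lt_div_iff₀' hg).2 hM)
  have hs0 : 0 < s := (specRad_nonneg M).trans_lt hMs
  have hlt : γ * s ^ 2 < 1 := by
    have h : Real.sqrt γ * s < 1 := (lt_div_iff₀' hg).1 hs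
    calc γ * s ^ 2 = (Real.sqrt γ * s) ^ 2 := by rw [mul_pow, Real.sq_sqrt hγ.le]
      _ < 1 := pow_lt_one₀ (by positivity) h two_ne_zero
  refine (summable_geometric_of_lt_one (by positivity) hlt).of_norm_bounded_eventually_nat ?_
  filter_upwards [eventually_norm_pow_le_of_specRad_lt M hMs] with t ht
  rw [Real.norm_of_nonneg (by positivity), mul_pow, ← pow_mul, mul_comm 2 t, pow_mul]
  gcongr

lemma hasSum_trace {n : ℕ} {f : ℕ → Matrix (Fin n) (Fin n) ℝ} (hs : Summable f) :
    HasSum (fun t => (f t).trace) (∑' t, f t).trace :=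
  hs.hasSum.map (Matrix.traceAddMonoidHom (Fin n) ℝ)
    (continuous_id.matrix_trace : Continuous fun M : Matrix (Fin n) (Fin n) ℝ => M.trace)

lemma norm_tsum_le_trace_tsum {n : ℕ} {f : ℕ → Matrix (Fin n) (Fin n) ℝ}
    (hf : ∀ t, (f t).PosSemidef) (hs : Summable f) : ‖∑' t, f t‖ ≤ (∑' t, f t).trace := by
  exact tsum_of_norm_bounded (hasSum_trace hs) fun t => norm_le_trace_of_posSemidef (hf t)

lemma summable_congr_series {n : ℕ} {M : Matrix (Fin n) (Fin n) ℝ} {γ : ℝ} (hγ : 0 < γ)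
    (hM : Real.sqrt γ * specRad M < 1) (W : Matrix (Fin n) (Fin n) ℝ) :
    Summable fun t : ℕ => γ ^ t • (Mᵀ ^ t * W * M ^ t) := by
  refine Summable.of_norm_bounded ((summable_pow_mul_norm_pow_sq hγ hM).mul_right ‖W‖) fun t => ?_
  rw [norm_smul, Real.norm_of_nonneg (by positivity), mul_assoc (γ ^ t), ← Matrix.transpose_pow]
  refine mul_le_mul_of_nonneg_left ?_ (by positivity)
  calc ‖(M ^ t)ᵀ * W * M ^ t‖ ≤ ‖(M ^ t)ᵀ‖ * ‖W‖ * ‖M ^ t‖ :=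
        (norm_mul_le _ _).trans
          (mul_le_mul_of_nonneg_right (norm_mul_le _ _) (norm_nonneg _))
    _ = ‖M ^ t‖ ^ 2 * ‖W‖ := by rw [Matrix.frobenius_norm_transpose]; ring

lemma norm_gramian_term_le {n : ℕ} {γ : ℝ} (hγ : 0 < γ) (M : Matrix (Fin n) (Fin n) ℝ) (t : ℕ) :
    ‖γ ^ t • (M ^ t * Mᵀ ^ t)‖ ≤ γ ^ t * ‖M ^ t‖ ^ 2 := by
  rw [norm_smul, Real.norm_of_nonneg (by positivity), ← Matrix.transpose_pow]
  refine mul_le_mul_of_nonneg_left ?_ (by positivity)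
  calc ‖M ^ t * (M ^ t)ᵀ‖ ≤ ‖M ^ t‖ * ‖(M ^ t)ᵀ‖ := norm_mul_le _ _
    _ = ‖M ^ t‖ ^ 2 := by rw [Matrix.frobenius_norm_transpose]; ring

variable {n m p : ℕ} {A : Matrix (Fin n) (Fin n) ℝ} {B : Matrix (Fin n) (Fin m) ℝ}
  {C : Matrix (Fin p) (Fin n) ℝ} {Q : Matrix (Fin n) (Fin n) ℝ} {R : Matrix (Fin m) (Fin m) ℝ}
  {K : Matrix (Fin m) (Fin p) ℝ} {γ l : ℝ}

lemma stageCost_sub_smul_one_posSemidef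
    (hQ : (Q - l • (1 : Matrix (Fin n) (Fin n) ℝ)).PosSemidef) (hR : R.PosSemidef) :
    (Q + Cᵀ * Kᵀ * R * K * C - l • (1 : Matrix (Fin n) (Fin n) ℝ)).PosSemidef := by
  convert hQ.add (hR.conjTranspose_mul_mul_same (K * C)) using 1
  rw [Matrix.conjTranspose_eq_transpose_of_trivial, Matrix.transpose_mul]
  simp only [Matrix.mul_assoc]
  abel

lemma hasSum_Jcost (hγ : 0 < γ) (hK : inS A B C γ K) :
    HasSum (fun t : ℕ => γ ^ t * ((Acl A B C K ^ t)ᵀ * (Q + Cᵀ * Kᵀ * R * K * C) *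
      Acl A B C K ^ t).trace) (Jcost A B C Q R γ K) := by
  have h := hasSum_trace (summable_congr_series hγ hK (Q + Cᵀ * Kᵀ * R * K * C))
  simp only [Matrix.trace_smul, smul_eq_mul] at h
  simpa only [Matrix.transpose_pow] using! h

lemma norm_Pmat_le_Jcost (hγ : 0 < γ) (hK : inS A B C γ K) (hQ : Q.PosSemidef)
    (hR : R.PosSemidef) : ‖Pmat A B C Q R γ K‖ ≤ Jcost A B C Q R γ K := by
  have hW : (Q + Cᵀ * Kᵀ * R * K * C).PosSemidef := by
    simpa using stageCost_sub_smul_one_posSemidef (C := C) (K := K) (l := 0) (by simpa) hR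
  refine norm_tsum_le_trace_tsum (fun t => ?_) (summable_congr_series hγ hK _)
  simpa [← Matrix.transpose_pow] using
    (hW.conjTranspose_mul_mul_same (Acl A B C K ^ t)).smul (pow_nonneg hγ.le t)

lemma mul_norm_Smat_le_Jcost (hγ : 0 < γ) (hK : inS A B C γ K) (hl : 0 < l)
    (hQ : (Q - l • (1 : Matrix (Fin n) (Fin n) ℝ)).PosSemidef) (hR : R.PosSemidef) :
    l * ‖Smat A B C γ K‖ ≤ Jcost A B C Q R γ K := by
  have hsum := summable_pow_mul_norm_pow_sq hγ hK
  have hS : ‖Smat A B C γ K‖ ≤ ∑' t : ℕ, γ ^ t * ‖Acl A B C K ^ t‖ ^ 2 := by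
    refine tsum_of_norm_bounded hsum.hasSum fun t => ?_
    exact norm_gramian_term_le hγ _ t
  refine (mul_le_mul_of_nonneg_left hS hl.le).trans ?_
  refine hasSum_le (fun t => ?_) (hsum.hasSum.mul_left l) (hasSum_Jcost (Q := Q) (R := R) hγ hK)
  rw [mul_left_comm]
  exact mul_le_mul_of_nonneg_left
    (mul_norm_sq_le_trace (stageCost_sub_smul_one_posSemidef hQ hR) _) (by positivity)

lemma pow_mul_trace_le_Jcost (hγ : 0 < γ) (hK : inS A B C γ K) (hQ : Q.PosSemidef)
    (hR : R.PosSemidef) (t : ℕ) :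
    γ ^ t * ((Acl A B C K ^ t)ᵀ * (Q + Cᵀ * Kᵀ * R * K * C) * Acl A B C K ^ t).trace ≤
      Jcost A B C Q R γ K := by
  have hW : (Q + Cᵀ * Kᵀ * R * K * C).PosSemidef := by
    simpa using stageCost_sub_smul_one_posSemidef (C := C) (K := K) (l := 0) (by simpa) hR
  exact le_hasSum (hasSum_Jcost hγ hK) t fun s _ =>
    mul_nonneg (pow_nonneg hγ.le s) (trace_congr_nonneg hW _)

lemma mul_norm_gain_sq_le_Jcost (hγ : 0 < γ) (hK : inS A B C γ K) (hQ : Q.PosSemidef)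
    (hl : 0 < l) (hR : (R - l • (1 : Matrix (Fin m) (Fin m) ℝ)).PosSemidef) :
    l * ‖K * C‖ ^ 2 ≤ Jcost A B C Q R γ K := by
  have h := pow_mul_trace_le_Jcost hγ hK hQ (posSemidef_of_sub_smul_one hl hR) 0
  rw [pow_zero, pow_zero, one_mul, Matrix.transpose_one, Matrix.one_mul, Matrix.mul_one,
    Matrix.trace_add] at h
  have h2 := mul_norm_sq_le_trace hR (K * C)
  rw [Matrix.transpose_mul] at h2
  simp only [← Matrix.mul_assoc] at h2
  linarith [hQ.trace_nonneg]

lemma mul_norm_Acl_sq_le_Jcost (hγ : 0 < γ) (hK : inS A B C γ K) (hl : 0 < l)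
    (hQ : (Q - l • (1 : Matrix (Fin n) (Fin n) ℝ)).PosSemidef) (hR : R.PosSemidef) :
    γ * (l * ‖Acl A B C K‖ ^ 2) ≤ Jcost A B C Q R γ K := by
  have h := pow_mul_trace_le_Jcost hγ hK (posSemidef_of_sub_smul_one hl hQ) hR 1
  rw [pow_one, pow_one] at h
  exact (mul_le_mul_of_nonneg_left
    (mul_norm_sq_le_trace (stageCost_sub_smul_one_posSemidef hQ hR) _) hγ.le).trans h

lemma Egrad_eq : Egrad A B C Q R γ K =
    R * (K * C) - Bᵀ * (Pmat A B C Q R γ K * (γ • Acl A B C K)) := by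
  simp only [Egrad, Acl, Matrix.add_mul, Matrix.mul_sub, Matrix.smul_mul, Matrix.mul_smul,
    smul_sub, Matrix.mul_assoc]
  abel

lemma frobNorm_gradJ_le (hm : 1 ≤ m) (hp : 1 ≤ p) {ℓ₀ ℓ₁ ψ φ ν : ℝ} (hℓ₀ : 0 < ℓ₀)
    (hℓ₀₁ : ℓ₀ ≤ ℓ₁) (hψ : 1 ≤ ψ) (hφ : 1 ≤ φ)
    (hQlb : (Q - ℓ₀ • (1 : Matrix (Fin n) (Fin n) ℝ)).PosSemidef)
    (hRlb : (R - ℓ₀ • (1 : Matrix (Fin m) (Fin m) ℝ)).PosSemidef)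
    (hRub : (ℓ₁ • (1 : Matrix (Fin m) (Fin m) ℝ) - R).PosSemidef)
    (hB : spNorm B ≤ ψ) (hC : spNorm C ≤ φ) (hγ : γ ∈ Set.Ioc (0 : ℝ) 1)
    (hK : inS A B C γ K) (hKν : Jcost A B C Q R γ K ≤ ν) :
    frobNorm (gradJ A B C Q R γ K) ≤
      2 * Real.sqrt (ν / ℓ₀) ^ 3 * φ * (ℓ₁ + ψ * ν) * Real.sqrt (min m p) := by
  have hγ0 := hγ.1
  have hℓ₁ : 0 < ℓ₁ := hℓ₀.trans_le hℓ₀₁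
  have hQ := posSemidef_of_sub_smul_one hℓ₀ hQlb
  have hR := posSemidef_of_sub_smul_one hℓ₀ hRlb
  have hP : ‖Pmat A B C Q R γ K‖ ≤ ν := (norm_Pmat_le_Jcost hγ0 hK hQ hR).trans hKν
  have hν : 0 ≤ ν := (norm_nonneg _).trans hP
  have hS : ‖Smat A B C γ K‖ ≤ Real.sqrt (ν / ℓ₀) ^ 2 := by
    rw [Real.sq_sqrt (by positivity), le_div_iff₀' hℓ₀]
    exact (mul_norm_Smat_le_Jcost hγ0 hK hℓ₀ hQlb hR).trans hKν
  have hL : ‖K * C‖ ≤ Real.sqrt (ν / ℓ₀) := by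
    refine Real.le_sqrt_of_sq_le ?_
    rw [le_div_iff₀' hℓ₀]
    exact (mul_norm_gain_sq_le_Jcost hγ0 hK hQ hℓ₀ hRlb).trans hKν
  have hM : ‖γ • Acl A B C K‖ ≤ Real.sqrt (ν / ℓ₀) := by
    refine Real.le_sqrt_of_sq_le ?_
    rw [le_div_iff₀' hℓ₀, norm_smul, Real.norm_of_nonneg hγ0.le]
    refine le_trans ?_ ((mul_norm_Acl_sq_le_Jcost hγ0 hK hℓ₀ hQlb hR).trans hKν)
    calc ℓ₀ * (γ * ‖Acl A B C K‖) ^ 2 = γ * (γ * (ℓ₀ * ‖Acl A B C K‖ ^ 2)) := by ring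
      _ ≤ γ * (ℓ₀ * ‖Acl A B C K‖ ^ 2) := mul_le_of_le_one_left (by positivity) hγ.2
  have hκ : 0 ≤ Real.sqrt (ν / ℓ₀) := Real.sqrt_nonneg _
  have hE : ‖Egrad A B C Q R γ K‖ ≤ Real.sqrt (ν / ℓ₀) * (ℓ₁ + ψ * ν) := by
    rw [Egrad_eq]
    calc _ ≤ ‖R * (K * C)‖ + ‖Bᵀ * (Pmat A B C Q R γ K * (γ • Acl A B C K))‖ := norm_sub_le _ _
      _ ≤ ℓ₁ * ‖K * C‖ + spNorm B * (‖Pmat A B C Q R γ K‖ * ‖γ • Acl A B C K‖) := by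
        refine add_le_add (norm_mul_le_of_posSemidef hℓ₁ hR hRub _) ?_
        rw [← spNorm_transpose]
        exact (norm_mul_le_spNorm _ _).trans
          (mul_le_mul_of_nonneg_left (norm_mul_le _ _) (norm_nonneg _))
      _ ≤ ℓ₁ * Real.sqrt (ν / ℓ₀) + ψ * (ν * Real.sqrt (ν / ℓ₀)) := by gcongr
      _ = _ := by ring
  have hmin : 1 ≤ Real.sqrt (min m p) := by
    rw [Real.one_le_sqrt]
    exact_mod_cast le_min hm hp
  rw [frobNorm_eq_norm, gradJ, norm_smul, Real.norm_of_nonneg zero_le_two]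
  calc _ ≤ 2 * (φ * (Real.sqrt (ν / ℓ₀) * (ℓ₁ + ψ * ν) * Real.sqrt (ν / ℓ₀) ^ 2)) := by
        refine mul_le_mul_of_nonneg_left ?_ zero_le_two
        refine (norm_mul_transpose_le_spNorm _ _).trans ?_
        have h := (Matrix.frobenius_norm_mul (Egrad A B C Q R γ K) (Smat A B C γ K)).trans
          (mul_le_mul hE hS (norm_nonneg _) (by positivity))
        exact mul_le_mul hC h (norm_nonneg _) (by positivity)
    _ = 2 * Real.sqrt (ν / ℓ₀) ^ 3 * φ * (ℓ₁ + ψ * ν) * 1 := by ring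
    _ ≤ _ := mul_le_mul_of_nonneg_left hmin (by positivity)

end FrobeniusBounds

/-- `‖∇J_γ(K)‖_F ≤ G⁰ = 2κ³φ(ℓ₁ + ψν)√(min{m,p})` on `S_γ(ν)`. -/
theorem stmt6
    {n m p : ℕ} (hn : 1 ≤ n) (hm : 1 ≤ m) (hp : 1 ≤ p)
    (A : Matrix (Fin n) (Fin n) ℝ) (B : Matrix (Fin n) (Fin m) ℝ) (C : Matrix (Fin p) (Fin n) ℝ)
    (Q : Matrix (Fin n) (Fin n) ℝ) (R : Matrix (Fin m) (Fin m) ℝ)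
    (hQsymm : Q.IsSymm) (hRsymm : R.IsSymm)
    (ℓ₀ ℓ₁ ψ φ : ℝ) (hℓ₀ : 0 < ℓ₀) (hℓ₀₁ : ℓ₀ ≤ ℓ₁) (hψ : 1 ≤ ψ) (hφ : 1 ≤ φ)
    (hQlb : (Q - ℓ₀ • (1 : Matrix (Fin n) (Fin n) ℝ)).PosSemidef)
    (hQub : (ℓ₁ • (1 : Matrix (Fin n) (Fin n) ℝ) - Q).PosSemidef)
    (hRlb : (R - ℓ₀ • (1 : Matrix (Fin m) (Fin m) ℝ)).PosSemidef)
    (hRub : (ℓ₁ • (1 : Matrix (Fin m) (Fin m) ℝ) - R).PosSemidef)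
    (hB : spNorm B ≤ ψ) (hC : spNorm C ≤ φ)
    (γ : ℝ) (hγ : γ ∈ Set.Ioc (0 : ℝ) 1) (ν : ℝ) (hν : 0 < ν)
    (K : Matrix (Fin m) (Fin p) ℝ)
    (hK : inS A B C γ K) (hKν : Jcost A B C Q R γ K ≤ ν) :
    frobNorm (gradJ A B C Q R γ K) ≤
      2 * Real.sqrt (ν / ℓ₀) ^ 3 * φ * (ℓ₁ + ψ * ν) * Real.sqrt (min m p) := by
  exact frobNorm_gradJ_le hm hp hℓ₀ hℓ₀₁ hψ hφ hQlb hRlb hRub hB hC hγ hK hKν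
end
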